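/- Bounded-marking criterion for stability (correctness of the Stabilize algorithm): let N be a CPN and δ a partition of N such that for every transition t∈T (i) there do not exist M₁,M₂ ∈ M^bounded(N) with M₁ ≡δ M₂, M₁ able to fire t, and M₂ unable to fire t, and (ii) there do not exist M₁,M₂ ∈ M^bounded(N) with M₁ ≡δ M₂ and some M₁' ∈ M^bounded(N) with M₁ →t M₁' such that every M₂' ∈ M^bounded(N) with M₂ →t M₂' satisfies M₁' ≢δ M₂'. Then δ is a stable partition of N. -/

import Mathlib

/- Formalization of colored Petri nets (CPN) following the paper's definitions. -/

noncomputable section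
attribute [local instance] Classical.propDecidable
attribute [local instance] Classical.decEq

/-- A colored Petri net `N = (P,T,ℂ,𝔹,C,G,W,W_I,M₀)`:
`dom` is the place color type function `C`, `guard` the guard evaluation `G`,
`pre`/`post` the arc evaluation `W` for place-to-transition and transition-to-place arcs,
`inhib` the inhibitor arc weight `W_I` (with `⊤` meaning no inhibitor arc),
and `M0` the initial marking. -/
structure CPN (P T C B : Type) where
  dom : P → Set C
  guard : T → B → Prop
  pre : P → T → B → Multiset C
  post : T → P → B → Multiset C
  inhib : P → T → ℕ∞
  M0 : P → Multiset C

variable {P T C B : Type}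

/-- Well-formedness conditions from the definition of a CPN: color domains are nonempty,
arc expressions only use colors from the color domain of the connected place, inhibitor
weights are positive, and the initial marking is a marking. -/
def CPN.WF (N : CPN P T C B) : Prop :=
  (∀ p, (N.dom p).Nonempty) ∧
  (∀ p t b, ∀ c ∈ N.pre p t b, c ∈ N.dom p) ∧
  (∀ p t b, ∀ c ∈ N.post t p b, c ∈ N.dom p) ∧
  (∀ p t, 0 < N.inhib p t) ∧
  (∀ p, ∀ c ∈ N.M0 p, c ∈ N.dom p)

/-- `M` is a marking of `N`: `set(M(p)) ⊆ C(p)` for all places `p`. -/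
def CPN.IsMk (N : CPN P T C B) (M : P → Multiset C) : Prop :=
  ∀ p, ∀ c ∈ M p, c ∈ N.dom p

/-- Transition firing `M →t M'`: there is a binding `b` satisfying the guard such that
`W((p,t),b) ⊆ M(p)` and `W_I(p,t) > |M(p)|` for all `p`, and
`M'(p) = (M(p) ∖ W((p,t),b)) ⊎ W((t,p),b)` for all `p`. -/
def CPN.Fires (N : CPN P T C B) (M : P → Multiset C) (t : T) (M' : P → Multiset C) : Prop :=
  ∃ b, N.guard t b ∧
    (∀ p, N.pre p t b ≤ M p) ∧
    (∀ p, ((M p).card : ℕ∞) < N.inhib p t) ∧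
    (∀ p, M' p = M p - N.pre p t b + N.post t p b)

/-- `Σ_{c∈θ} S(c)`: the number of elements of the multiset `S` whose color lies in `θ`. -/
def countIn (S : Multiset C) (θ : Set C) : ℕ := (S.filter (· ∈ θ)).card

/-- `M ≡δ M'` iff for all `p ∈ P` and all `θ ∈ δ(p)`, `Σ_{c∈θ}M(p)(c) = Σ_{c∈θ}M'(p)(c)`. -/
def MarkEquiv (δ : P → Set (Set C)) (M M' : P → Multiset C) : Prop :=
  ∀ p, ∀ θ ∈ δ p, countIn (M p) θ = countIn (M' p) θ

/-- `δ` is a partition of `N`: for each place `p`, the equivalence classes in `δ(p)` are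
nonempty, pairwise disjoint, and their union is `C(p)`. -/
def CPN.IsPartition (N : CPN P T C B) (δ : P → Set (Set C)) : Prop :=
  ∀ p, ∅ ∉ δ p ∧ ⋃₀ δ p = N.dom p ∧
    ∀ θ₁ ∈ δ p, ∀ θ₂ ∈ δ p, θ₁ ≠ θ₂ → θ₁ ∩ θ₂ = ∅

/-- `δ` is stable: the relation `≡δ` on markings of `N` is a bisimulation on the LTS of `N`
labeled by transition names (stated for one direction; the other follows by symmetry of `≡δ`). -/
def CPN.IsStable (N : CPN P T C B) (δ : P → Set (Set C)) : Prop :=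
  ∀ M₁ M₂, N.IsMk M₁ → N.IsMk M₂ → MarkEquiv δ M₁ M₂ →
    ∀ t M₁', N.Fires M₁ t M₁' → ∃ M₂', N.Fires M₂ t M₂' ∧ MarkEquiv δ M₁' M₂'

/-- The maximum arc size `max(N) = max_{p,t,b}(|W((p,t),b)|, |W((t,p),b)|)`. -/
def CPN.maxArc (N : CPN P T C B) [Fintype P] [Fintype T] [Fintype B] : ℕ :=
  Finset.univ.sup fun x : P × T × B =>
    max (N.pre x.1 x.2.1 x.2.2).card (N.post x.2.1 x.1 x.2.2).card

/-- `M` is bounded: `|M(p)| ≤ max(N)` for all `p`; together with `IsMk` this says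
`M ∈ M^bounded(N)`. -/
def CPN.Bounded (N : CPN P T C B) [Fintype P] [Fintype T] [Fintype B]
    (M : P → Multiset C) : Prop :=
  ∀ p, (M p).card ≤ N.maxArc

theorem countIn_zero (θ : Set C) : countIn (0 : Multiset C) θ = 0 := by
  simp [countIn]

theorem countIn_add (S S' : Multiset C) (θ : Set C) :
    countIn (S + S') θ = countIn S θ + countIn S' θ := by
  simp [countIn]

theorem countIn_cons (a : C) (S : Multiset C) (θ : Set C) :
    countIn (a ::ₘ S) θ = countIn S θ + if a ∈ θ then 1 else 0 := by
  by_cases h : a ∈ θ <;> simp [countIn, h]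

theorem countIn_pos {S : Multiset C} {θ : Set C} : 0 < countIn S θ ↔ ∃ c ∈ S, c ∈ θ := by
  simp [countIn, Multiset.card_pos_iff_exists_mem]

/-- Two colors are related when they lie in the same members of the family `Θ`. -/
def SameClass (Θ : Set (Set C)) (c d : C) : Prop :=
  ∀ θ ∈ Θ, c ∈ θ ↔ d ∈ θ

theorem countIn_eq_of_rel {Θ : Set (Set C)} {S S' : Multiset C}
    (h : Multiset.Rel (SameClass Θ) S S') {θ : Set C} (hθ : θ ∈ Θ) :
    countIn S θ = countIn S' θ := by
  induction h with
  | zero => rfl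
  | cons hab _ ih => simp only [countIn_cons, ih, hab θ hθ]

theorem rel_of_countIn_eq {Θ : Set (Set C)}
    (hdisj : ∀ θ₁ ∈ Θ, ∀ θ₂ ∈ Θ, θ₁ ≠ θ₂ → θ₁ ∩ θ₂ = ∅) {S S' : Multiset C}
    (hS : ∀ c ∈ S, c ∈ ⋃₀ Θ) (hS' : ∀ c ∈ S', c ∈ ⋃₀ Θ)
    (h : ∀ θ ∈ Θ, countIn S θ = countIn S' θ) : Multiset.Rel (SameClass Θ) S S' := by
  induction S using Multiset.induction_on generalizing S' with
  | empty =>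
    have hzero : S' = 0 := by
      refine Multiset.eq_zero_of_forall_notMem fun c hc => ?_
      obtain ⟨θ, hθ, hcθ⟩ := hS' c hc
      have hpos : 0 < countIn S' θ := countIn_pos.2 ⟨c, hc, hcθ⟩
      rw [← h θ hθ, countIn_zero] at hpos
      exact lt_irrefl _ hpos
    rw [hzero]
    exact Multiset.Rel.zero
  | cons a S ih =>
    obtain ⟨θ, hθ, haθ⟩ := hS a (Multiset.mem_cons_self a S)
    have hpos : 0 < countIn S' θ := by
      rw [← h θ hθ]
      exact countIn_pos.2 ⟨a, Multiset.mem_cons_self a S, haθ⟩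
    obtain ⟨a', ha', haθ'⟩ := countIn_pos.1 hpos
    obtain ⟨S'', rfl⟩ := Multiset.exists_cons_of_mem ha'
    have hclass : ∀ d ∈ θ, ∀ η ∈ Θ, d ∈ η → η = θ := by
      intro d hd η hη hdη
      by_contra hne
      have hmem : d ∈ η ∩ θ := ⟨hdη, hd⟩
      rw [hdisj η hη θ hθ hne] at hmem
      exact hmem
    have haa' : SameClass Θ a a' := fun η hη =>
      ⟨fun ha => hclass a haθ η hη ha ▸ haθ', fun ha => hclass a' haθ' η hη ha ▸ haθ⟩
    refine Multiset.Rel.cons haa' (ih (fun c hc => hS c (Multiset.mem_cons_of_mem hc))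
      (fun c hc => hS' c (Multiset.mem_cons_of_mem hc)) fun η hη => ?_)
    have heq := h η hη
    simp only [countIn_cons, haa' η hη] at heq
    exact Nat.add_right_cancel heq

theorem CPN.card_pre_le_maxArc (N : CPN P T C B) [Fintype P] [Fintype T] [Fintype B]
    (p : P) (t : T) (b : B) : (N.pre p t b).card ≤ N.maxArc :=
  (le_max_left _ _).trans (Finset.le_sup (f := fun x : P × T × B =>
    max (N.pre x.1 x.2.1 x.2.2).card (N.post x.2.1 x.1 x.2.2).card) (Finset.mem_univ (p, t, b)))

theorem CPN.card_post_le_maxArc (N : CPN P T C B) [Fintype P] [Fintype T] [Fintype B]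
    (p : P) (t : T) (b : B) : (N.post t p b).card ≤ N.maxArc :=
  (le_max_right _ _).trans (Finset.le_sup (f := fun x : P × T × B =>
    max (N.pre x.1 x.2.1 x.2.2).card (N.post x.2.1 x.1 x.2.2).card) (Finset.mem_univ (p, t, b)))

/-- Bounded-marking criterion for stability (correctness of `Stabilize`):
if for every transition `t` no pair of bounded markings witnesses a violation of the
bisimulation property of `≡δ` (neither through enabledness (i) nor through successor
equivalence (ii)), then `δ` is a stable partition of `N`. -/
theorem bounded_criterion_stable [Fintype P] [Fintype T] [Fintype B]
    (N : CPN P T C B) (hWF : N.WF) (δ : P → Set (Set C)) (hpart : N.IsPartition δ)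
    (h₁ : ∀ t : T, ¬ ∃ M₁ M₂ : P → Multiset C, N.IsMk M₁ ∧ N.IsMk M₂ ∧
        N.Bounded M₁ ∧ N.Bounded M₂ ∧ MarkEquiv δ M₁ M₂ ∧
        (∃ M', N.Fires M₁ t M') ∧ ¬ ∃ M', N.Fires M₂ t M')
    (h₂ : ∀ t : T, ¬ ∃ M₁ M₂ : P → Multiset C, N.IsMk M₁ ∧ N.IsMk M₂ ∧
        N.Bounded M₁ ∧ N.Bounded M₂ ∧ MarkEquiv δ M₁ M₂ ∧
        ∃ M₁', N.IsMk M₁' ∧ N.Bounded M₁' ∧ N.Fires M₁ t M₁' ∧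
          ∀ M₂', N.IsMk M₂' → N.Bounded M₂' → N.Fires M₂ t M₂' →
            ¬ MarkEquiv δ M₁' M₂') :
    N.IsStable δ := by
  intro M₁ M₂ hM₁ hM₂ hequiv t M₁' hfire
  obtain ⟨b, hguard, hpre, hinh, hM₁'⟩ := hfire
  obtain ⟨-, hWpre, hWpost, -, -⟩ := hWF
  have hrel : ∀ p, Multiset.Rel (SameClass (δ p)) (M₁ p) (M₂ p) := fun p =>
    rel_of_countIn_eq (hpart p).2.2 (by rw [(hpart p).2.1]; exact hM₁ p)
      (by rw [(hpart p).2.1]; exact hM₂ p) (hequiv p)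
  have hsplit : ∀ p, ∃ A R, Multiset.Rel (SameClass (δ p)) (N.pre p t b) A ∧
      Multiset.Rel (SameClass (δ p)) (M₁ p - N.pre p t b) R ∧ M₂ p = A + R := by
    intro p
    rw [← Multiset.rel_add_left, add_tsub_cancel_of_le (hpre p)]
    exact hrel p
  choose A R hA hR hAR using hsplit
  have hAM : ∀ p, A p ≤ M₂ p := fun p => hAR p ▸ Multiset.le_add_right _ _
  have hfirePre : N.Fires (fun p => N.pre p t b) t fun p => N.post t p b :=
    ⟨b, hguard, fun _ => le_rfl,
      fun p => lt_of_le_of_lt (Nat.cast_le.2 (Multiset.card_le_card (hpre p))) (hinh p),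
      fun p => by simp⟩
  obtain ⟨A', ⟨b', hguard', hpre', -, hA'⟩, hequiv'⟩ :
      ∃ A', N.Fires A t A' ∧ MarkEquiv δ (fun p => N.post t p b) A' := by
    by_contra hnone
    refine h₂ t ⟨fun p => N.pre p t b, A, fun p => hWpre p t b,
      fun p c hc => hM₂ p c (Multiset.mem_of_le (hAM p) hc),
      fun p => N.card_pre_le_maxArc p t b,
      fun p => Multiset.card_eq_card_of_rel (hA p) ▸ N.card_pre_le_maxArc p t b,
      fun p θ hθ => countIn_eq_of_rel (hA p) hθ,
      fun p => N.post t p b, fun p => hWpost p t b, fun p => N.card_post_le_maxArc p t b,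
      hfirePre, fun A' _ _ hf he => hnone ⟨A', hf, he⟩⟩
  refine ⟨fun p => A' p + R p, ⟨b', hguard', fun p => (hpre' p).trans (hAM p), fun p => ?_,
    fun p => ?_⟩, fun p θ hθ => ?_⟩
  · rw [← Multiset.card_eq_card_of_rel (hrel p)]
    exact hinh p
  · change A' p + R p = _
    rw [hA' p, hAR p, ← tsub_add_eq_add_tsub (hpre' p), add_right_comm]
  · change _ = countIn (A' p + R p) θ
    rw [hM₁' p, countIn_add, countIn_add, countIn_eq_of_rel (hR p) hθ, hequiv' p θ hθ, add_comm]

end
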